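/- Let G be a finite group whose character graph Δ(G) is K₄-free and has exactly seven vertices, so that G ≅ PSL₂(2^f) × R(G) for some f ≥ 2. If 2^f − 1 and 2^f + 1 each have exactly three prime divisors, then R(G) is abelian and Δ(G) is isomorphic to the disjoint union K₃ ∪ K₁ ∪ K₃. -/

import Mathlib

open CategoryTheory

/-- `cd(G)`: the set of character degrees of `G`, i.e. the dimensions of the simple
finite-dimensional complex representations of `G`. -/
def charDegrees (G : Type) [Group G] : Set ℕ :=
  { n | ∃ V : FDRep ℂ G, Simple V ∧ Module.finrank ℂ V = n }

/-- `ρ(G)`: the set of primes dividing some character degree of `G`. -/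
def charPrimes (G : Type) [Group G] : Set ℕ :=
  { p | p.Prime ∧ ∃ n ∈ charDegrees G, p ∣ n }

/-- The character graph `Δ(G)`, on vertex set `ρ(G)`: two distinct primes `p`, `q`
are adjacent iff `p * q` divides some character degree of `G`. -/
def charGraph (G : Type) [Group G] : SimpleGraph (charPrimes G) where
  Adj p q := (p : ℕ) ≠ (q : ℕ) ∧ ∃ n ∈ charDegrees G, (p : ℕ) * (q : ℕ) ∣ n
  symm := by
    refine ⟨?_⟩
    rintro p q ⟨h, n, hn, hd⟩
    exact ⟨fun e => h e.symm, n, hn, by rwa [mul_comm]⟩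
  loopless := by refine ⟨?_⟩; rintro p ⟨h, -⟩; exact h rfl

/-- The solvable radical `R(G)` of `G`: the largest solvable normal subgroup of `G`
(realized as the join of all solvable normal subgroups). -/
def solvableRadical (G : Type*) [Group G] : Subgroup G :=
  ⨆ N : { N : Subgroup G // N.Normal ∧ IsSolvable ↥N }, (N : Subgroup G)

instance solvableRadical_normal (G : Type*) [Group G] : (solvableRadical G).Normal := by
  constructor
  intro n hn g
  refine Subgroup.iSup_induction (C := fun x => g * x * g⁻¹ ∈ solvableRadical G)
    (fun N : { N : Subgroup G // N.Normal ∧ IsSolvable ↥N } => (N : Subgroup G)) hn ?_ ?_ ?_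
  · intro N x hx
    exact Subgroup.mem_iSup_of_mem N (N.2.1.conj_mem x hx g)
  · simpa using Subgroup.one_mem _
  · intro x y hx hy
    have h : g * (x * y) * g⁻¹ = (g * x * g⁻¹) * (g * y * g⁻¹) := by group
    rw [h]; exact Subgroup.mul_mem _ hx hy

/-- `PSL₂(F)`: the special linear group `SL₂(F)` modulo its center. -/
abbrev PSL2 (F : Type) [Field F] :=
  Matrix.SpecialLinearGroup (Fin 2) F ⧸
    Subgroup.center (Matrix.SpecialLinearGroup (Fin 2) F)

/-- The join `Γ ⋆ Δ` of two simple graphs: the disjoint union together with all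
edges between the two vertex sets. -/
def graphJoin {α β : Type*} (G : SimpleGraph α) (H : SimpleGraph β) :
    SimpleGraph (α ⊕ β) :=
  (G ⊕g H) ⊔
    { Adj := fun u v => u.isLeft ≠ v.isLeft
      symm := ⟨fun _ _ h => h.symm⟩
      loopless := ⟨fun _ h => h rfl⟩ }

/-- The image of a subgroup `M` of `G` in `G/R(G)`; when `R(G) ≤ M` this is `M/R(G)`. -/
def radicalQuotImage {G : Type*} [Group G] (M : Subgroup G) :
    Subgroup (G ⧸ solvableRadical G) :=
  M.map (QuotientGroup.mk' (solvableRadical G))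


theorem irr_iff {G V : Type} [Group G] [AddCommGroup V] [Module ℂ V]
    (ρ : Representation ℂ G V) : ρ.IsIrreducible ↔ Nontrivial V ∧
      ∀ W : Submodule ℂ V, (∀ g, ∀ v ∈ W, ρ g v ∈ W) → W = ⊥ ∨ W = ⊤ := by
  constructor
  · intro h
    have h1 := h.exists_pair_ne
    constructor
    · by_contra hn
      rw [not_nontrivial_iff_subsingleton] at hn
      obtain ⟨x, y, hxy⟩ := h1
      apply hxy
      apply Subrepresentation.toSubmodule_injective
      exact Subsingleton.elim _ _
    · intro W hW
      rcases eq_bot_or_eq_top (⟨W, fun g v hv => hW g v hv⟩ : Subrepresentation ρ) with h2 | h2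
      · left; exact congrArg Subrepresentation.toSubmodule h2
      · right; exact congrArg Subrepresentation.toSubmodule h2
  · rintro ⟨h1, h2⟩
    refine @IsSimpleOrder.mk _ _ _ ⟨⊥, ⊤, ?_⟩ ?_
    · intro h
      have : (⊥ : Submodule ℂ V) = ⊤ := congrArg Subrepresentation.toSubmodule h
      exact bot_ne_top this
    · intro a
      rcases h2 a.toSubmodule (fun g v hv => a.apply_mem_toSubmodule g hv) with h | h
      · left; exact Subrepresentation.toSubmodule_injective h
      · right; exact Subrepresentation.toSubmodule_injective h

theorem finrank_one_irr {G V : Type} [Group G] [Finite G] [AddCommGroup V] [Module ℂ V]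
    [FiniteDimensional ℂ V]
    (ρ : Representation ℂ G V) (h : Module.finrank ℂ (Representation.IntertwiningMap ρ ρ) = 1) :
    ρ.IsIrreducible := by
  have hid : ∀ f : Representation.IntertwiningMap ρ ρ, ∃ c : ℂ, ∀ v, f v = c • v := by
    by_cases h0 : Representation.IntertwiningMap.id ρ = 0
    · intro f
      refine ⟨0, fun v => ?_⟩
      have : v = 0 := by
        have := congrArg (fun f => f v) h0
        simpa using this
      simp [this]
    · intro f
      obtain ⟨c, hc⟩ := (finrank_eq_one_iff_of_nonzero' _ h0).mp h f
      refine ⟨c, fun v => ?_⟩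
      rw [← hc]; simp
  rw [irr_iff]
  constructor
  · by_contra hn
    rw [not_nontrivial_iff_subsingleton] at hn
    have : Subsingleton (Representation.IntertwiningMap ρ ρ) :=
      ⟨fun a b => by ext v; exact Subsingleton.elim _ _⟩
    rw [Module.finrank_zero_of_subsingleton] at h
    simp at h
  · intro W hW
    have : NeZero (Nat.card G : ℂ) := ⟨by exact_mod_cast Nat.card_pos.ne'⟩
    let W' : Submodule (MonoidAlgebra ℂ G) ρ.asModule :=
      Subrepresentation.asSubmodule (⟨W, fun g v hv => hW g v hv⟩ : Subrepresentation ρ)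
    obtain ⟨Q, hQ⟩ := exists_isCompl W'
    let p : ρ.asModule →ₗ[MonoidAlgebra ℂ G] ρ.asModule := W'.subtype ∘ₗ W'.projectionOnto Q hQ
    obtain ⟨c, hc⟩ := hid ((Representation.IntertwiningMap.equivLinearMapAsModule ρ ρ).symm p)
    have hp1 : ∀ v : V, v ∈ W → c • v = v := by
      intro v hv
      rw [← hc]
      have : p v = v := by
        exact congrArg Subtype.val (Submodule.projectionOnto_apply_left hQ ⟨v, hv⟩)
      exact this
    have hp2 : ∀ v : V, c • v ∈ W := by
      intro v
      rw [← hc]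
      exact (W'.projectionOnto Q hQ v).2
    by_cases hc0 : c = 0
    · left
      rw [eq_bot_iff]; intro v hv
      have := hp1 v hv
      simp [hc0] at this
      simp [this]
    · right
      rw [eq_top_iff]; intro v _
      have := W.smul_mem c⁻¹ (hp2 v)
      rwa [smul_smul, inv_mul_cancel₀ hc0, one_smul] at this

theorem irr_iff_norm {G V : Type} [Group G] [Fintype G] [AddCommGroup V] [Module ℂ V]
    [FiniteDimensional ℂ V] (ρ : Representation ℂ G V) :
    ρ.IsIrreducible ↔ ∑ g : G, ρ.character g * ρ.character g⁻¹ = Nat.card G := by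
  have hne : (Nat.card G : ℂ) ≠ 0 := by exact_mod_cast Nat.card_pos.ne'
  have := invertibleOfNonzero hne
  have key := Representation.card_inv_mul_sum_char_mul_char_eq_finrank ρ ρ
  constructor
  · intro h
    rw [Representation.IsIrreducible.finrank_intertwiningMap_self] at key
    field_simp at key
    simpa using key
  · intro h
    apply finrank_one_irr
    rw [h, inv_mul_cancel₀ hne] at key
    exact_mod_cast key.symm

theorem simple_iff_irr {G : Type} [Group G] [Finite G] (V : FDRep ℂ G) :
    Simple V ↔ Representation.IsIrreducible (V.ρ : Representation ℂ G V) := by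
  have := Fintype.ofFinite G
  rw [FDRep.simple_iff_char_is_norm_one, irr_iff_norm]
  rfl



theorem irr_mem {G V : Type} [Group G] [Finite G] [AddCommGroup V] [Module ℂ V]
    [FiniteDimensional ℂ V] (ρ : Representation ℂ G V) (h : ρ.IsIrreducible) :
    Module.finrank ℂ V ∈ charDegrees G :=
  ⟨FDRep.of ρ, (simple_iff_irr _).2 h, rfl⟩

theorem mem_irr {G : Type} [Group G] [Finite G] {n : ℕ} (h : n ∈ charDegrees G) :
    ∃ (V : Type) (_ : AddCommGroup V) (_ : Module ℂ V) (_ : FiniteDimensional ℂ V)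
      (ρ : Representation ℂ G V), ρ.IsIrreducible ∧ Module.finrank ℂ V = n := by
  obtain ⟨V, hV, hn⟩ := h
  exact ⟨V, inferInstance, inferInstance, inferInstance, V.ρ, (simple_iff_irr _).1 hV, hn⟩

theorem irr_comp {G H V : Type} [Group G] [Group H] [AddCommGroup V] [Module ℂ V]
    (ρ : Representation ℂ G V) (h : ρ.IsIrreducible) (φ : H →* G) (hφ : Function.Surjective φ) :
    Representation.IsIrreducible (ρ.comp φ : Representation ℂ H V) := by
  rw [irr_iff] at h ⊢
  refine ⟨h.1, fun W hW => h.2 W fun g v hv => ?_⟩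
  obtain ⟨x, rfl⟩ := hφ g
  exact hW x v hv

theorem charDegrees_equiv {G H : Type} [Group G] [Group H] [Finite G] [Finite H] (e : G ≃* H) :
    charDegrees G = charDegrees H := by
  have key : ∀ {G H : Type} [Group G] [Group H] [Finite G] [Finite H] (e : G ≃* H),
      charDegrees G ⊆ charDegrees H := by
    intro G H _ _ _ _ e n hn
    obtain ⟨V, _, _, _, ρ, h, rfl⟩ := mem_irr hn
    exact irr_mem _ (irr_comp ρ h e.symm.toMonoidHom e.symm.surjective)
  exact Set.Subset.antisymm (key e) (key e.symm)

theorem irr_degree_prod {A B : Type} [Group A] [Group B] [Finite A] [Finite B] {m n : ℕ}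
    (hm : m ∈ charDegrees A) (hn : n ∈ charDegrees B) : m * n ∈ charDegrees (A × B) := by
  have := Fintype.ofFinite A
  have := Fintype.ofFinite B
  obtain ⟨V, _, _, _, ρ, h, rfl⟩ := mem_irr hm
  obtain ⟨W, _, _, _, σ, h', rfl⟩ := mem_irr hn
  rw [← Module.finrank_tensorProduct (R := ℂ)]
  let ρ' : Representation ℂ (A × B) V := ρ.comp (MonoidHom.fst A B)
  let σ' : Representation ℂ (A × B) W := σ.comp (MonoidHom.snd A B)
  refine irr_mem (ρ'.tprod σ') ?_
  rw [irr_iff_norm] at h h' ⊢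
  rw [Representation.char_tensor, Nat.card_prod, Nat.cast_mul, ← h, ← h', Finset.sum_mul_sum,
    Fintype.sum_prod_type]
  refine Finset.sum_congr rfl fun a _ => Finset.sum_congr rfl fun b _ => ?_
  have h1 : ∀ x, ρ'.character x = ρ.character x.1 := fun x => rfl
  have h2 : ∀ x, σ'.character x = σ.character x.2 := fun x => rfl
  simp only [Pi.mul_apply, h1, h2, Prod.fst_inv, Prod.snd_inv]
  ring

theorem one_mem_charDegrees {G : Type} [Group G] [Finite G] : 1 ∈ charDegrees G := by
  rw [← Module.finrank_self ℂ]
  refine irr_mem (Representation.trivial ℂ G ℂ) ?_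
  rw [irr_iff]
  refine ⟨inferInstance, fun W _ => ?_⟩
  exact eq_bot_or_eq_top W

/-- Degrees for product with a commutative group. -/
theorem irr_degree_prod_comm {A B : Type} [Group A] [Group B] [Finite A] [Finite B] {n : ℕ}
    (hB : ∀ x y : B, x * y = y * x) (hn : n ∈ charDegrees (A × B)) : n ∈ charDegrees A := by
  obtain ⟨V, _, _, _, ρ, h, rfl⟩ := mem_irr hn
  refine irr_mem (ρ.comp (MonoidHom.inl A B)) ?_
  have hs : ∀ b : B, ∃ c : ℂ, ∀ v, ρ (1, b) v = c • v := by
    intro b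
    rw [irr_iff] at h
    have := h.1
    obtain ⟨c, hc⟩ := Module.End.exists_eigenvalue (ρ (1, b))
    refine ⟨c, fun v => ?_⟩
    have h3 := h.2 (Module.End.eigenspace (ρ (1, b)) c) (by
      intro g v hv
      rw [Module.End.mem_eigenspace_iff] at hv ⊢
      have : (1, b) * g = g * (1, b) := by
        ext <;> simp [hB]
      rw [← Module.End.mul_apply, ← map_mul, this, map_mul, Module.End.mul_apply, hv, map_smul])
    rcases h3 with h3 | h3
    · exact absurd h3 hc
    · rw [← Module.End.mem_eigenspace_iff, h3]; trivial
  rw [irr_iff] at h ⊢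
  refine ⟨h.1, fun W hW => h.2 W ?_⟩
  rintro ⟨a, b⟩ v hv
  have : ((a, b) : A × B) = (a, 1) * (1, b) := by simp
  rw [this, map_mul, Module.End.mul_apply]
  obtain ⟨c, hc⟩ := hs b
  rw [hc, map_smul]
  exact W.smul_mem _ (hW a v hv)

theorem mat_comm_aux {k : ℕ} [Subsingleton (Fin k)] (A B : Matrix (Fin k) (Fin k) ℂ) :
    A * B = B * A := by
  ext a b
  obtain rfl : a = b := Subsingleton.elim _ _
  rw [Matrix.mul_apply, Matrix.mul_apply, Fintype.sum_subsingleton _ a,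
    Fintype.sum_subsingleton _ a, mul_comm]

theorem wedderburn_G (G : Type) [Group G] [Finite G] :
    ∃ (n : ℕ) (d : Fin n → ℕ), (∀ i, d i ∈ charDegrees G) ∧ ∑ i, (d i) ^ 2 = Nat.card G ∧
      ((∀ φ : G →* ℂ, φ = 1) → ∀ i j, d i = 1 → d j = 1 → i = j) ∧
      ((∀ i, d i = 1) → ∀ x y : G, x * y = y * x) ∧ ∀ i, d i ≠ 0 := by
  have := Fintype.ofFinite G
  have : NeZero (Nat.card G : ℂ) := ⟨by exact_mod_cast Nat.card_pos.ne'⟩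
  obtain ⟨n, d, hd, ⟨e⟩⟩ :=
    IsSemisimpleRing.exists_algEquiv_pi_matrix_of_isAlgClosed ℂ (MonoidAlgebra ℂ G)
  refine ⟨n, d, ?_, ?_, ?_, ?_, fun i => (hd i).out⟩
  · intro i
    let π : MonoidAlgebra ℂ G →ₐ[ℂ] Matrix (Fin (d i)) (Fin (d i)) ℂ :=
      (Pi.evalAlgHom ℂ _ i).comp e.toAlgHom
    have hπ : Function.Surjective π := by
      intro m
      refine ⟨e.symm (Pi.single i m), ?_⟩
      simp [π]
    let ρ : Representation ℂ G (Fin (d i) → ℂ) :=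
      ((Matrix.toLinAlgEquiv' : Matrix (Fin (d i)) (Fin (d i)) ℂ ≃ₐ[ℂ] _).toAlgHom.toMonoidHom.comp
        π.toMonoidHom).comp (MonoidAlgebra.of ℂ G)
    have hρ : ∀ g v, ρ g v = (π (MonoidAlgebra.of ℂ G g)).mulVec v := fun g v => rfl
    have : Module.finrank ℂ (Fin (d i) → ℂ) = d i := by simp
    rw [← this]
    refine irr_mem ρ ?_
    rw [irr_iff]
    have hdi := hd i
    refine ⟨inferInstance, fun W hW => ?_⟩
    have hall : ∀ M : Matrix (Fin (d i)) (Fin (d i)) ℂ, ∀ v ∈ W, M.mulVec v ∈ W := by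
      intro M v hv
      obtain ⟨a, rfl⟩ := hπ M
      induction a using MonoidAlgebra.induction_on with
      | of g => rw [← hρ]; exact hW g v hv
      | add f g hf hg => rw [map_add, Matrix.add_mulVec]; exact W.add_mem hf hg
      | smul r f hf => rw [map_smul, Matrix.smul_mulVec]; exact W.smul_mem _ hf
    by_cases h0 : W = ⊥
    · left; exact h0
    · right
      obtain ⟨v, hv, hv0⟩ := Submodule.exists_mem_ne_zero_of_ne_bot h0
      obtain ⟨j, hj⟩ := Function.ne_iff.1 hv0
      rw [eq_top_iff]
      intro w _
      have h9 := hall (Matrix.vecMulVec w (Pi.single j (v j)⁻¹)) v hv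
      have h10 : (Matrix.vecMulVec w (Pi.single j (v j)⁻¹)).mulVec v = w := by
        funext a
        have : v j ≠ 0 := hj
        simp [Matrix.mulVec, dotProduct, Matrix.vecMulVec_apply, Pi.single_apply, this]
      rwa [h10] at h9
  · have h1 := e.toLinearEquiv.finrank_eq
    rw [Module.finrank_pi_fintype] at h1
    rw [(Module.finrank_eq_card_basis (MonoidAlgebra.basis G ℂ) : Module.finrank ℂ (MonoidAlgebra ℂ G) = Fintype.card G)] at h1
    simp only [Module.finrank_matrix, Module.finrank_self, Fintype.card_fin] at h1
    rw [Nat.card_eq_fintype_card, h1]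
    exact Finset.sum_congr rfl fun i _ => by ring
  · intro hφ i j hi hj
    by_contra hij
    let t : ∀ i, G →* Matrix (Fin (d i)) (Fin (d i)) ℂ := fun i =>
      ((Pi.evalAlgHom ℂ (fun i => Matrix (Fin (d i)) (Fin (d i)) ℂ) i).comp e.toAlgHom).toMonoidHom.comp (MonoidAlgebra.of ℂ G)
    have ht : ∀ i, d i = 1 → ∀ a b g, (t i g) a b = 1 := by
      intro i hi a b g
      have hsub : Subsingleton (Fin (d i)) := by rw [hi]; infer_instance
      obtain rfl : a = b := Subsingleton.elim _ _
      let ψ : G →* ℂ := (Matrix.detMonoidHom).comp (t i)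
      have h2 := congrArg (fun f : G →* ℂ => f g) (hφ ψ)
      have h3 : ψ g = (t i g) a a := by
        change Matrix.det (t i g) = _
        exact Matrix.det_eq_elem_of_subsingleton _ a
      rw [← h3, h2]; rfl
    have h0i : 0 < d i := by omega
    have h0j : 0 < d j := by omega
    have hlin : ∀ x : MonoidAlgebra ℂ G, e x i ⟨0, h0i⟩ ⟨0, h0i⟩ = e x j ⟨0, h0j⟩ ⟨0, h0j⟩ := by
      intro x
      induction x using MonoidAlgebra.induction_on with
      | of g => exact (ht i hi _ _ g).trans (ht j hj _ _ g).symm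
      | add f g hf hg => rw [map_add]; exact congrArg₂ (· + ·) hf hg
      | smul r f hf => rw [map_smul]; exact congrArg (r * ·) hf
    have := hlin (e.symm (Pi.single i 1))
    simp [Pi.single_eq_of_ne (Ne.symm hij)] at this
  · intro h1 x y
    apply MonoidAlgebra.of_injective (R := ℂ)
    apply e.injective
    rw [map_mul, map_mul, map_mul, map_mul]
    funext i
    have hsub : Subsingleton (Fin (d i)) := by rw [h1]; infer_instance
    exact mat_comm_aux _ _

namespace SLT
open Matrix

variable {F : Type} [Field F]

abbrev S (F : Type) [Field F] := Matrix.SpecialLinearGroup (Fin 2) F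

def u (x : F) : S F := ⟨!![1, x; 0, 1], by simp⟩
def lo (x : F) : S F := ⟨!![1, 0; x, 1], by simp⟩
def t (a : Fˣ) : S F := ⟨!![(a : F), 0; 0, ((a⁻¹ : Fˣ) : F)], by simp⟩
def w (c : Fˣ) : S F := ⟨!![0, -((c⁻¹ : Fˣ) : F); (c : F), 0], by simp⟩

theorem cu (x : F) : (u x).1 = !![1, x; 0, 1] := rfl
theorem clo (x : F) : (lo x).1 = !![1, 0; x, 1] := rfl
theorem ct (a : Fˣ) : (t a).1 = !![(a : F), 0; 0, ((a⁻¹ : Fˣ) : F)] := rfl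
theorem cw (c : Fˣ) : (w c).1 = !![0, -((c⁻¹ : Fˣ) : F); (c : F), 0] := rfl
theorem cm (g h : S F) (i j : Fin 2) : (g * h).1 i j = g.1 i 0 * h.1 0 j + g.1 i 1 * h.1 1 j := by
  have : (g * h).1 = g.1 * h.1 := rfl
  rw [this, Matrix.mul_apply, Fin.sum_univ_two]

theorem u_add (x y : F) : u (x + y) = u x * u y := by
  ext i j; fin_cases i <;> fin_cases j <;> simp [cu, cm, add_comm]

theorem u_zero : u (0 : F) = 1 := by
  ext i j; fin_cases i <;> fin_cases j <;> simp [cu]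

theorem t_mul (a b : Fˣ) : t (a * b) = t a * t b := by
  ext i j; fin_cases i <;> fin_cases j <;> simp [ct, cm, mul_comm]

def tHom : Fˣ →* S F where
  toFun := t
  map_one' := by ext i j; fin_cases i <;> fin_cases j <;> simp [ct]
  map_mul' := t_mul

theorem det_eq (g : S F) : g 0 0 * g 1 1 - g 0 1 * g 1 0 = 1 := by
  have := g.2
  rwa [Matrix.det_fin_two] at this

theorem w_u_w (c d : Fˣ) (y : F) : (w c * u y * w d).1 =
    !![-((d : F) * (c⁻¹ : Fˣ)), 0; (c : F) * y * d, -((c : F) * (d⁻¹ : Fˣ))] := by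
  ext i j; fin_cases i <;> fin_cases j <;>
    simp [cw, cu, cm, mul_comm]

/-- conjugating `u x` by an upper triangular element. -/
theorem upper_conj (g : S F) (h : g 1 0 = 0) (x : F) : g * u x = u (g 0 0 ^ 2 * x) * g := by
  have hd := det_eq g
  rw [h] at hd
  have hd' : g.1 0 0 * g.1 1 1 = 1 := by simpa using hd
  have h' : g.1 1 0 = 0 := h
  ext i j; fin_cases i <;> fin_cases j <;>
    simp [cu, cm, h'] 
  linear_combination (-(g.1 0 0) * x) * hd'

theorem t_conj (a : Fˣ) (x : F) : t a * u x = u ((a : F) ^ 2 * x) * t a := by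
  exact upper_conj (t a) (by simp [ct]) x

theorem bruhat (g : S F) (c : Fˣ) (h : g 1 0 = c) :
    g = u (g 0 0 * (c⁻¹ : Fˣ)) * w c * u (g 1 1 * (c⁻¹ : Fˣ)) := by
  have hd := det_eq g
  have h' : g.1 1 0 = c := h
  ext i j; fin_cases i <;> fin_cases j <;>
    simp [cu, cw, cm, h']
  · rw [h] at hd
    field_simp
    change g.1 0 0 * g.1 1 1 - g.1 0 1 * c = 1 at hd
    linear_combination -hd
  · field_simp

theorem borel (g : S F) (h : g 1 0 = 0) : ∃ a : Fˣ, (a : F) = g 0 0 ∧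
    g = t a * u ((a⁻¹ : Fˣ) * g 0 1) := by
  have hd := det_eq g
  rw [h] at hd
  have hd' : g.1 0 0 * g.1 1 1 = 1 := by simpa using hd
  have h' : g.1 1 0 = 0 := h
  have h0 : g.1 0 0 ≠ 0 := by intro h0; simp [h0] at hd'
  refine ⟨Units.mk0 _ h0, rfl, ?_⟩
  ext i j; fin_cases i <;> fin_cases j <;>
    simp [cu, ct, cm, h', h0]
  exact eq_inv_of_mul_eq_one_right hd'

theorem normal_top (N : Subgroup (S F)) [hN : N.Normal] (h : ∀ x, u x ∈ N) : N = ⊤ := by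
  have hlo : ∀ x, lo x ∈ N := by
    intro x
    have := hN.conj_mem (u (-x)) (h (-x)) (w 1)
    convert this using 1
    rw [eq_mul_inv_iff_mul_eq]
    ext i j; fin_cases i <;> fin_cases j <;>
      simp [cu, cw, clo, cm]
  have key : ∀ g : S F, g 1 0 ≠ 0 → g ∈ N := by
    intro g hg
    have hd := det_eq g
    have hg' : g.1 1 0 ≠ 0 := hg
    have : g = u ((g 0 0 - 1) / g 1 0) * lo (g 1 0) * u ((g 1 1 - 1) / g 1 0) := by
      ext i j; fin_cases i <;> fin_cases j <;>
        simp [cu, clo, cm] <;> field_simp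
      · ring
      · change g.1 0 0 * g.1 1 1 - g.1 0 1 * g.1 1 0 = 1 at hd
        linear_combination -hd
      · ring
    rw [this]
    exact N.mul_mem (N.mul_mem (h _) (hlo _)) (h _)
  rw [eq_top_iff]
  intro g _
  by_cases hg : g 1 0 = 0
  · have hd := det_eq g
    rw [hg] at hd
    have h1 : g * lo 1 ∈ N := by
      apply key
      have : (g * lo 1).1 1 0 = g.1 1 1 + g.1 1 0 := by
        simp [clo, cm, add_comm]
      rw [this]
      have hg' : g.1 1 0 = 0 := hg
      rw [hg', add_zero]
      intro h0
      change g.1 0 0 * g.1 1 1 - _ = 1 at hd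
      simp [h0] at hd
    have := N.mul_mem h1 (N.inv_mem (hlo 1))
    simpa using this
  · exact key g hg

end SLT

namespace SLT
open Matrix

variable {F : Type} [Field F] [Fintype F] {V : Type} [AddCommGroup V] [Module ℂ V]

noncomputable def P (ρ : Representation ℂ (S F) V) (ψ : AddChar F ℂ) (b : F) : Module.End ℂ V :=
  ((Fintype.card F : ℂ)⁻¹) • ∑ x : F, ψ (-(x * b)) • ρ (u x)

def Vb (ρ : Representation ℂ (S F) V) (ψ : AddChar F ℂ) (b : F) : Submodule ℂ V where
  carrier := {v | ∀ x, ρ (u x) v = ψ (x * b) • v}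
  add_mem' := by
    intro v v' h h' x
    rw [map_add, h, h', smul_add]
  zero_mem' := by intro x; simp
  smul_mem' := by
    intro c v h x
    rw [map_smul, h, smul_comm]

theorem mem_Vb (ρ : Representation ℂ (S F) V) (ψ : AddChar F ℂ) (b : F) (v : V) :
    v ∈ Vb ρ ψ b ↔ ∀ x, ρ (u x) v = ψ (x * b) • v := Iff.rfl

variable (ρ : Representation ℂ (S F) V) (ψ : AddChar F ℂ)

theorem cardF : (Fintype.card F : ℂ) ≠ 0 := by
  exact_mod_cast Fintype.card_ne_zero

theorem u_mul_P (b y : F) : ρ (u y) * P ρ ψ b = ψ (y * b) • P ρ ψ b := by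
  unfold P
  rw [mul_smul_comm, smul_comm, Finset.mul_sum]
  refine congrArg _ ?_
  rw [Finset.smul_sum]
  refine Fintype.sum_equiv (Equiv.addLeft y) _ _ fun x => ?_
  rw [mul_smul_comm, ← map_mul, ← u_add, smul_smul, ← AddChar.map_add_eq_mul]
  simp only [Equiv.coe_addLeft]
  congr 2
  ring

theorem P_mul_u (b y : F) : P ρ ψ b * ρ (u y) = ψ (y * b) • P ρ ψ b := by
  unfold P
  rw [smul_mul_assoc, smul_comm, Finset.sum_mul]
  refine congrArg _ ?_
  rw [Finset.smul_sum]
  refine Fintype.sum_equiv (Equiv.addRight y) _ _ fun x => ?_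
  rw [smul_mul_assoc, ← map_mul, ← u_add, smul_smul, ← AddChar.map_add_eq_mul]
  simp only [Equiv.coe_addRight]
  congr 2
  ring

theorem P_mem (b : F) (v : V) : P ρ ψ b v ∈ Vb ρ ψ b := by
  intro x
  have := congrArg (fun f : Module.End ℂ V => f v) (u_mul_P ρ ψ b x)
  simpa using this

theorem P_id (b : F) (v : V) (hv : v ∈ Vb ρ ψ b) : P ρ ψ b v = v := by
  unfold P
  rw [LinearMap.smul_apply, LinearMap.sum_apply]
  have : ∀ x ∈ (Finset.univ : Finset F), (ψ (-(x * b)) • ρ (u x)) v = v := by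
    intro x _
    rw [LinearMap.smul_apply, hv x, smul_smul, ← AddChar.map_add_eq_mul, neg_add_cancel,
      AddChar.map_zero_eq_one, one_smul]
  rw [Finset.sum_congr rfl this, Finset.sum_const, Finset.card_univ, ← Nat.cast_smul_eq_nsmul ℂ,
    smul_smul, inv_mul_cancel₀ cardF, one_smul]

theorem P_proj (b : F) : LinearMap.IsProj (Vb ρ ψ b) (P ρ ψ b) :=
  ⟨P_mem ρ ψ b, P_id ρ ψ b⟩

theorem P_sq (b : F) : P ρ ψ b * P ρ ψ b = P ρ ψ b := by
  ext v
  exact P_id ρ ψ b _ (P_mem ρ ψ b v)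

theorem sum_P (hψ : ψ.IsPrimitive) : ∑ b, P ρ ψ b = 1 := by
  classical
  unfold P
  rw [← Finset.smul_sum, Finset.sum_comm]
  have : ∀ x ∈ (Finset.univ : Finset F), ∑ b, ψ (-(x * b)) • ρ (u x) =
      if x = 0 then (Fintype.card F : ℂ) • (1 : Module.End ℂ V) else 0 := by
    intro x _
    rw [← Finset.sum_smul]
    have h1 := AddChar.sum_mulShift (-x) hψ
    have h2 : ∀ b, -(x * b) = b * -x := fun b => by ring
    simp_rw [h2, h1]
    by_cases hx : x = 0
    · simp [hx, u_zero]
    · simp [hx]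
  rw [Finset.sum_congr rfl this]
  simp [smul_smul, cardF]

theorem finrank_sum [FiniteDimensional ℂ V] (hψ : ψ.IsPrimitive) :
    ∑ b, Module.finrank ℂ (Vb ρ ψ b) = Module.finrank ℂ V := by
  have h := congrArg (LinearMap.trace ℂ V) (sum_P ρ ψ hψ)
  rw [map_sum, LinearMap.trace_one] at h
  have : ∀ b ∈ (Finset.univ : Finset F), LinearMap.trace ℂ V (P ρ ψ b) =
      (Module.finrank ℂ (Vb ρ ψ b) : ℂ) := fun b _ => (P_proj ρ ψ b).trace
  rw [Finset.sum_congr rfl this] at h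
  exact_mod_cast h

theorem t_Vb (a : Fˣ) (b : F) (v : V) (hv : v ∈ Vb ρ ψ ((a : F) ^ 2 * b)) :
    ρ (t a) v ∈ Vb ρ ψ b := by
  intro x
  have h := t_conj a (((a⁻¹ : Fˣ) : F) ^ 2 * x)
  have h1 : (a : F) ^ 2 * ((((a⁻¹ : Fˣ) : F)) ^ 2 * x) = x := by
    rw [← mul_assoc, ← mul_pow]; simp
  rw [h1] at h
  rw [← Module.End.mul_apply, ← map_mul, ← h, map_mul, Module.End.mul_apply, hv, map_smul]
  congr 2
  calc _ = ((a : F) ^ 2 * ((((a⁻¹ : Fˣ) : F)) ^ 2 * x)) * b := by ring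
    _ = _ := by rw [h1]

theorem t_inj (g : S F) : Function.Injective (ρ g) := by
  intro v v' h
  have := congrArg (ρ g⁻¹) h
  rw [← Module.End.mul_apply, ← Module.End.mul_apply, ← map_mul] at this
  simpa using this

theorem finrank_Vb_le [FiniteDimensional ℂ V] (a : Fˣ) (b : F) :
    Module.finrank ℂ (Vb ρ ψ ((a : F) ^ 2 * b)) ≤ Module.finrank ℂ (Vb ρ ψ b) := by
  let f : Vb ρ ψ ((a : F) ^ 2 * b) →ₗ[ℂ] Vb ρ ψ b :=
    (ρ (t a)).restrict (fun v hv => t_Vb ρ ψ a b v hv)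
  refine LinearMap.finrank_le_finrank_of_injective (f := f) ?_
  intro v v' h
  apply Subtype.ext
  exact t_inj ρ (t a) (congrArg Subtype.val h)

theorem exists_sq [CharP F 2] (b : F) (hb : b ≠ 0) : ∃ a : Fˣ, (a : F) ^ 2 = b := by
  obtain ⟨r, hr⟩ := FiniteField.isSquare_of_char_two (ringChar.eq F 2) b
  have : r ≠ 0 := by rintro rfl; simp at hr; exact hb hr
  exact ⟨Units.mk0 r this, by rw [Units.val_mk0, hr, sq]⟩

theorem finrank_Vb [CharP F 2] [FiniteDimensional ℂ V] (b : F) (hb : b ≠ 0) :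
    Module.finrank ℂ (Vb ρ ψ b) = Module.finrank ℂ (Vb ρ ψ 1) := by
  obtain ⟨a, ha⟩ := exists_sq b hb
  apply le_antisymm
  · have := finrank_Vb_le ρ ψ a 1
    rwa [mul_one, ha] at this
  · have := finrank_Vb_le ρ ψ a⁻¹ b
    rwa [← ha, ← mul_pow, Units.inv_mul, one_pow, ha] at this

theorem finrank_eq [CharP F 2] [FiniteDimensional ℂ V] (hψ : ψ.IsPrimitive) :
    Module.finrank ℂ V = Module.finrank ℂ (Vb ρ ψ 0) +
      (Fintype.card F - 1) * Module.finrank ℂ (Vb ρ ψ 1) := by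
  classical
  rw [← finrank_sum ρ ψ hψ, Fintype.sum_eq_add_sum_compl 0]
  congr 1
  rw [Finset.sum_congr rfl (g := fun _ => Module.finrank ℂ (Vb ρ ψ 1))]
  · rw [Finset.sum_const, Finset.card_compl, Finset.card_singleton, smul_eq_mul]
  · intro b hb
    exact finrank_Vb ρ ψ b (by simpa using hb)

/-- trivial case -/
theorem trivial_case [CharP F 2] [FiniteDimensional ℂ V] (hψ : ψ.IsPrimitive)
    (h0 : Module.finrank ℂ (Vb ρ ψ 1) = 0) : ∀ g, ρ g = 1 := by
  classical
  have h1 : ∀ b : F, b ≠ 0 → P ρ ψ b = 0 := by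
    intro b hb
    rw [← finrank_Vb ρ ψ b hb] at h0
    have h2 := Submodule.finrank_eq_zero.1 h0
    ext v
    have h3 := P_mem ρ ψ b v
    rw [h2] at h3
    simpa using h3
  have h2 : P ρ ψ 0 = 1 := by
    rw [← sum_P ρ ψ hψ, Fintype.sum_eq_single 0 h1]
  have h3 : ∀ x, ρ (u x) = 1 := by
    intro x
    have := u_mul_P ρ ψ 0 x
    rw [h2] at this
    simpa using this
  have h4 := normal_top (MonoidHom.ker ρ) h3
  intro g
  have : g ∈ MonoidHom.ker ρ := by rw [h4]; trivial
  exact this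

theorem span_orbit (hρ : ρ.IsIrreducible) (v : V) (hv : v ≠ 0) :
    Submodule.span ℂ (Set.range fun g => ρ g v) = ⊤ := by
  rw [irr_iff] at hρ
  have h := hρ.2 (Submodule.span ℂ (Set.range fun g => ρ g v)) (by
    intro g w hw
    have : Submodule.span ℂ (Set.range fun g => ρ g v) ≤
        (Submodule.span ℂ (Set.range fun g => ρ g v)).comap (ρ g) := by
      rw [Submodule.span_le]
      rintro _ ⟨k, rfl⟩
      apply Submodule.subset_span
      refine ⟨g * k, ?_⟩
      simp [map_mul]
    exact this hw)
  rcases h with h | h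
  · exfalso
    apply hv
    have : v ∈ Submodule.span ℂ (Set.range fun g => ρ g v) :=
      Submodule.subset_span ⟨1, by simp⟩
    rw [h] at this
    simpa using this
  · exact h

theorem principal_case [FiniteDimensional ℂ V] (hρ : ρ.IsIrreducible)
    (h0 : Vb ρ ψ 0 ≠ ⊥) : Module.finrank ℂ V ≤ Fintype.card F + 1 := by
  obtain ⟨a, ha⟩ := IsCyclic.exists_generator (α := Fˣ)
  have hT : ∀ b : Fˣ, ∀ v ∈ Vb ρ ψ 0, ρ (t b) v ∈ Vb ρ ψ 0 := by
    intro b v hv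
    apply t_Vb
    simpa using hv
  have : Nontrivial (Vb ρ ψ 0) := Submodule.nontrivial_iff_ne_bot.2 h0
  obtain ⟨c, hc⟩ := Module.End.exists_eigenvalue ((ρ (t a)).restrict (hT a))
  obtain ⟨⟨v, hv⟩, hvc⟩ := hc.exists_hasEigenvector
  have hv0 : v ≠ 0 := by
    intro h; apply hvc.2; exact Subtype.ext h
  have hva : ρ (t a) v = c • v := congrArg Subtype.val hvc.apply_eq_smul
  have hc0 : c ≠ 0 := by
    rintro rfl
    rw [zero_smul] at hva
    apply hv0
    apply t_inj ρ (t a)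
    rw [hva, map_zero]
  have hvT : ∀ b : Fˣ, ∃ c : ℂ, ρ (t b) v = c • v := by
    intro b
    obtain ⟨k, rfl⟩ := Subgroup.mem_zpowers_iff.1 (ha b)
    have hzp : t (a ^ k) = (t a) ^ k := map_zpow (tHom (F := F)) a k
    rw [hzp]
    have hn : ∀ n : ℕ, ∃ c : ℂ, ρ ((t a) ^ n) v = c • v := by
      intro n
      induction n with
      | zero => exact ⟨1, by simp⟩
      | succ n ih =>
        obtain ⟨c', h'⟩ := ih
        refine ⟨c * c', ?_⟩
        rw [pow_succ, map_mul, Module.End.mul_apply, hva, map_smul, h', smul_smul]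
    obtain ⟨n, hn'⟩ : ∃ n : ℕ, (t a) ^ k = (t a) ^ n := by
      have : Finite (S F) := inferInstance
      have h1 : (t a) ^ k ∈ Submonoid.powers (t a) := by
        rw [mem_powers_iff_mem_zpowers]; exact ⟨k, rfl⟩
      obtain ⟨n, hn⟩ := h1
      exact ⟨n, hn.symm⟩
    rw [hn']
    exact hn n
  have hvu : ∀ x, ρ (u x) v = v := by
    intro x; rw [hv x]; simp
  let f : Option F → V := fun o => o.elim v (fun x => ρ (u x) (ρ (w 1) v))
  have hspan : Submodule.span ℂ (Set.range f) = ⊤ := by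
    rw [eq_top_iff, ← span_orbit ρ hρ v hv0, Submodule.span_le]
    rintro _ ⟨g, rfl⟩
    by_cases hg : g 1 0 = 0
    · obtain ⟨b, -, hb⟩ := borel g hg
      obtain ⟨c', hc'⟩ := hvT b
      simp only
      rw [hb, map_mul, Module.End.mul_apply, hvu, hc']
      exact Submodule.smul_mem _ _ (Submodule.subset_span ⟨none, rfl⟩)
    · have hb := bruhat g (Units.mk0 _ hg) rfl
      have hw : w (Units.mk0 _ hg) = w 1 * t (Units.mk0 _ hg) := by
        ext i j; fin_cases i <;> fin_cases j <;> simp [cw, ct, cm]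
      obtain ⟨c', hc'⟩ := hvT (Units.mk0 _ hg)
      simp only
      rw [hb, map_mul, Module.End.mul_apply, hvu, hw, map_mul, Module.End.mul_apply, map_mul,
        Module.End.mul_apply, hc', map_smul, map_smul]
      exact Submodule.smul_mem _ _ (Submodule.subset_span ⟨some _, rfl⟩)
  have := finrank_range_le_card (R := ℂ) f
  rw [Set.finrank, hspan, finrank_top, Fintype.card_option] at this
  exact this

end SLT

namespace SLT
open Matrix

variable {F : Type} [Field F] [Fintype F] {V : Type} [AddCommGroup V] [Module ℂ V]
variable (ρ : Representation ℂ (S F) V) (ψ : AddChar F ℂ)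

noncomputable def T (g : S F) : Module.End ℂ V := P ρ ψ 1 * ρ g * P ρ ψ 1

theorem T_u (x y : F) (g : S F) : T ρ ψ (u x * g * u y) = ψ (x + y) • T ρ ψ g := by
  unfold T
  rw [map_mul, map_mul]
  calc _ = (P ρ ψ 1 * ρ (u x)) * ρ g * (ρ (u y) * P ρ ψ 1) := by simp only [mul_assoc]
    _ = _ := by
      rw [P_mul_u, u_mul_P, smul_mul_assoc, smul_mul_assoc, mul_smul_comm, smul_smul,
        AddChar.map_add_eq_mul, mul_one, mul_one]

theorem T_big (g : S F) (c : Fˣ) (h : g 1 0 = c) :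
    T ρ ψ g = ψ ((g 0 0 + g 1 1) * (c⁻¹ : Fˣ)) • T ρ ψ (w c) := by
  conv_lhs => rw [bruhat g c h]
  rw [T_u, add_mul]

theorem T_upper (hψ : ψ.IsPrimitive) (g : S F) (h : g 1 0 = 0) (h1 : g 0 0 ^ 2 ≠ 1) :
    T ρ ψ g = 0 := by
  have h2 := hψ (sub_ne_zero.2 h1)
  obtain ⟨x, hx⟩ := AddChar.ne_one_iff.1 h2
  rw [AddChar.mulShift_apply] at hx
  have h3 := upper_conj g h x
  have h4 : T ρ ψ (u 0 * g * u x) = T ρ ψ (u (g 0 0 ^ 2 * x) * g * u 0) := by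
    rw [u_zero, one_mul, mul_one, h3]
  rw [T_u, T_u, zero_add, add_zero] at h4
  have h5 : ψ ((g 0 0 ^ 2 - 1) * x) * ψ x = ψ (g 0 0 ^ 2 * x) := by
    rw [← AddChar.map_add_eq_mul]; congr 1; ring
  have h6 : (ψ x * (ψ ((g 0 0 ^ 2 - 1) * x) - 1)) • T ρ ψ g = 0 := by
    have : ψ x * (ψ ((g 0 0 ^ 2 - 1) * x) - 1) = ψ (g 0 0 ^ 2 * x) - ψ x := by
      rw [← h5]; ring
    rw [this, sub_smul, h4, sub_self]
  rcases smul_eq_zero.1 h6 with h7 | h7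
  · exfalso
    rcases mul_eq_zero.1 h7 with h8 | h8
    · have : ψ x * ψ (-x) = 1 := by
        rw [← AddChar.map_add_eq_mul, add_neg_cancel, AddChar.map_zero_eq_one]
      rw [h8, zero_mul] at this
      exact zero_ne_one this
    · exact hx (sub_eq_zero.1 h8)
  · exact h7

theorem sq_one [CharP F 2] (a : F) (h : a ^ 2 = 1) : a = 1 := by
  have h2 : (2 : F) = 0 := by exact_mod_cast CharP.cast_eq_zero F 2
  have : (a - 1) ^ 2 = 0 := by linear_combination h + (1 - a) * h2
  exact sub_eq_zero.1 (pow_eq_zero_iff (two_ne_zero) |>.1 this)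

theorem T_sym [CharP F 2] (hψ : ψ.IsPrimitive) (g h : S F) (h10 : g 1 0 = h 1 0)
    (h01 : g 0 1 = h 0 1) (h00 : g 0 0 = h 1 1) (h11 : g 1 1 = h 0 0) : T ρ ψ g = T ρ ψ h := by
  by_cases hc : g 1 0 = 0
  · have hd := det_eq g
    rw [hc, mul_zero, sub_zero] at hd
    by_cases ha : g 0 0 ^ 2 = 1
    · have ha' := sq_one _ ha
      rw [ha', one_mul] at hd
      have : g = h := by
        ext i j; fin_cases i <;> fin_cases j
        · exact ha'.trans (hd.symm.trans h11)
        · exact h01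
        · exact h10
        · exact hd.trans (ha'.symm.trans h00)
      rw [this]
    · rw [T_upper ρ ψ hψ g hc ha, T_upper ρ ψ hψ h (h10 ▸ hc)]
      intro hb
      apply ha
      rw [← h11] at hb
      have hb' := sq_one _ hb
      rw [hb', mul_one] at hd
      rw [hd, one_pow]
  · rw [T_big ρ ψ g (Units.mk0 _ hc) rfl, T_big ρ ψ h (Units.mk0 _ hc) h10.symm, h00, h11, add_comm]

theorem T_w_mul (c d : Fˣ) : T ρ ψ (w c) * T ρ ψ (w d) =
    (Fintype.card F : ℂ)⁻¹ • ∑ y : F, ψ (-(y * 1)) • T ρ ψ (w c * u y * w d) := by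
  have : T ρ ψ (w c) * T ρ ψ (w d) =
      (P ρ ψ 1 * ρ (w c)) * (P ρ ψ 1 * P ρ ψ 1) * (ρ (w d) * P ρ ψ 1) := by
    unfold T; simp only [mul_assoc]
  rw [this, P_sq]
  conv_lhs => enter [1, 2]; unfold P
  rw [mul_smul_comm, smul_mul_assoc]
  refine congrArg _ ?_
  rw [Finset.mul_sum, Finset.sum_mul]
  refine Finset.sum_congr rfl fun y _ => ?_
  rw [mul_smul_comm, smul_mul_assoc]
  unfold T
  simp only [map_mul, mul_assoc]

theorem T_w_comm [CharP F 2] (hψ : ψ.IsPrimitive) (c d : Fˣ) :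
    T ρ ψ (w c) * T ρ ψ (w d) = T ρ ψ (w d) * T ρ ψ (w c) := by
  rw [T_w_mul, T_w_mul]
  refine congrArg _ (Finset.sum_congr rfl fun y _ => congrArg _ ?_)
  apply T_sym ρ ψ hψ <;> simp only [w_u_w] <;> simp <;> ring

theorem T_form [CharP F 2] (hψ : ψ.IsPrimitive) (g : S F) :
    ∃ k : ℂ, T ρ ψ g = k • P ρ ψ 1 ∨ ∃ c, T ρ ψ g = k • T ρ ψ (w c) := by
  by_cases hc : g 1 0 = 0
  · by_cases ha : g 0 0 ^ 2 = 1
    · have ha' := sq_one _ ha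
      have hd := det_eq g
      rw [hc, mul_zero, sub_zero, ha', one_mul] at hd
      have : g = u (g 0 1) * 1 * u 0 := by
        rw [u_zero, mul_one, mul_one]
        ext i j; fin_cases i <;> fin_cases j
        · exact ha'
        · rfl
        · exact hc
        · exact hd
      refine ⟨ψ (g 0 1 + 0), Or.inl ?_⟩
      conv_lhs => rw [this]
      rw [T_u]
      unfold T
      rw [map_one, mul_one, P_sq]
    · exact ⟨0, Or.inl (by rw [T_upper ρ ψ hψ g hc ha, zero_smul])⟩
  · exact ⟨_, Or.inr ⟨_, T_big ρ ψ g (Units.mk0 _ hc) rfl⟩⟩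

theorem PT (g : S F) : P ρ ψ 1 * T ρ ψ g = T ρ ψ g := by
  unfold T; rw [← mul_assoc, ← mul_assoc, P_sq]

theorem TP (g : S F) : T ρ ψ g * P ρ ψ 1 = T ρ ψ g := by
  unfold T; rw [mul_assoc, P_sq]

theorem T_comm [CharP F 2] (hψ : ψ.IsPrimitive) (g h : S F) :
    T ρ ψ g * T ρ ψ h = T ρ ψ h * T ρ ψ g := by
  obtain ⟨k, hk | ⟨c, hk⟩⟩ := T_form ρ ψ hψ g
  · rw [hk, smul_mul_assoc, mul_smul_comm, PT, TP]
  · obtain ⟨l, hl | ⟨d, hl⟩⟩ := T_form ρ ψ hψ h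
    · rw [hl, smul_mul_assoc, mul_smul_comm, PT, TP]
    · rw [hk, hl, smul_mul_assoc, mul_smul_comm, smul_mul_assoc, mul_smul_comm, T_w_comm ρ ψ hψ,
        smul_comm]

/-- `P V` is spanned by the `T_g v`. -/
theorem V1_le (hρ : ρ.IsIrreducible) (v : V) (hv0 : v ≠ 0) (hv : v ∈ Vb ρ ψ 1)
    (E : Submodule ℂ V) (hE : ∀ g, T ρ ψ g v ∈ E) : Vb ρ ψ 1 ≤ E := by
  intro x hx
  have h1 : (⊤ : Submodule ℂ V) ≤ E.comap (P ρ ψ 1) := by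
    rw [← span_orbit ρ hρ v hv0, Submodule.span_le]
    rintro _ ⟨g, rfl⟩
    have := hE g
    unfold T at this
    rw [Module.End.mul_apply, P_id ρ ψ 1 v hv] at this
    exact this
  have h2 : P ρ ψ 1 x ∈ E := h1 (Submodule.mem_top)
  rwa [P_id ρ ψ 1 x hx] at h2

theorem T_mem (g : S F) (v : V) : T ρ ψ g v ∈ Vb ρ ψ 1 := by
  unfold T
  rw [mul_assoc, Module.End.mul_apply]
  exact P_mem ρ ψ 1 _

theorem mult_one [CharP F 2] [FiniteDimensional ℂ V] (hψ : ψ.IsPrimitive) (hρ : ρ.IsIrreducible) :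
    Module.finrank ℂ (Vb ρ ψ 1) ≤ 1 := by
  by_cases h0 : Vb ρ ψ 1 = ⊥
  · rw [h0]; simp
  have : Nontrivial (Vb ρ ψ 1) := Submodule.nontrivial_iff_ne_bot.2 h0
  have hscal : ∀ g, ∃ c : ℂ, ∀ v ∈ Vb ρ ψ 1, T ρ ψ g v = c • v := by
    intro g
    obtain ⟨c, hc⟩ := Module.End.exists_eigenvalue
      ((T ρ ψ g).restrict (p := Vb ρ ψ 1) (q := Vb ρ ψ 1) (fun v _ => T_mem ρ ψ g v))
    obtain ⟨⟨v, hv⟩, hvc⟩ := hc.exists_hasEigenvector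
    have hv0 : v ≠ 0 := by
      intro h; apply hvc.2; exact Subtype.ext h
    have hva : T ρ ψ g v = c • v := congrArg Subtype.val hvc.apply_eq_smul
    refine ⟨c, fun x hx => ?_⟩
    have := V1_le ρ ψ hρ v hv0 hv (Module.End.eigenspace (T ρ ψ g) c) (by
      intro h
      rw [Module.End.mem_eigenspace_iff, ← Module.End.mul_apply, T_comm ρ ψ hψ,
        Module.End.mul_apply, hva, map_smul]) hx
    exact Module.End.mem_eigenspace_iff.1 this
  obtain ⟨v, hv, hv0⟩ := Submodule.exists_mem_ne_zero_of_ne_bot h0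
  have := V1_le ρ ψ hρ v hv0 hv (Submodule.span ℂ {v}) (by
    intro g
    obtain ⟨c, hc⟩ := hscal g
    rw [hc v hv]
    exact Submodule.smul_mem _ _ (Submodule.mem_span_singleton_self v))
  calc _ ≤ _ := Submodule.finrank_mono this
    _ ≤ 1 := by rw [finrank_span_singleton hv0]

theorem one_dim [FiniteDimensional ℂ V] (hρ : ρ.IsIrreducible) (h : ∀ g, ρ g = 1) :
    Module.finrank ℂ V = 1 := by
  rw [irr_iff] at hρ
  have := hρ.1
  obtain ⟨v, hv⟩ := exists_ne (0 : V)
  rcases hρ.2 (Submodule.span ℂ {v}) (fun g x hx => by rw [h]; exact hx) with h1 | h1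
  · exact absurd (Submodule.span_singleton_eq_bot.1 h1) hv
  · rw [← finrank_top, ← h1, finrank_span_singleton hv]

theorem dims [CharP F 2] [FiniteDimensional ℂ V] (hρ : ρ.IsIrreducible) :
    Module.finrank ℂ V = 1 ∨ Module.finrank ℂ V = Fintype.card F - 1 ∨
      Module.finrank ℂ V = Fintype.card F ∨ Module.finrank ℂ V = Fintype.card F + 1 := by
  obtain ⟨ψ, hψ⟩ : ∃ ψ : AddChar F ℂ, ψ.IsPrimitive := by
    exact ⟨AddChar.FiniteField.primitiveChar_to_Complex F,
      AddChar.FiniteField.primitiveChar_to_Complex_isPrimitive F⟩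
  have h1 := finrank_eq ρ ψ hψ
  have h2 := mult_one ρ ψ hψ hρ
  have hq : 1 < Fintype.card F := Fintype.one_lt_card
  by_cases h3 : Module.finrank ℂ (Vb ρ ψ 1) = 0
  · left
    exact one_dim ρ hρ (trivial_case ρ ψ hψ h3)
  · right
    have h4 : Module.finrank ℂ (Vb ρ ψ 1) = 1 := by omega
    rw [h4, mul_one] at h1
    by_cases h5 : Vb ρ ψ 0 = ⊥
    · left
      rw [h5] at h1
      simpa using h1
    · have h6 := principal_case ρ ψ hρ h5
      omega

theorem hom_trivial [CharP F 2] (hq : 2 < Fintype.card F) (φ : S F →* ℂ) : φ = 1 := by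
  classical
  have h0 : ∃ a : Fˣ, (a : F) ^ 2 ≠ 1 := by
    by_contra! h
    have h1 : ∀ a : Fˣ, a = 1 := fun a => Units.ext (sq_one _ (h a))
    have : Fintype.card Fˣ ≤ 1 := Fintype.card_le_one_iff.2 fun a b => by rw [h1 a, h1 b]
    rw [Fintype.card_units] at this
    omega
  obtain ⟨a, ha⟩ := h0
  have h1 : ∀ x, φ (u ((a : F) ^ 2 * x)) = φ (u x) := by
    intro x
    have h2 := congrArg φ (t_conj a x)
    rw [map_mul, map_mul, mul_comm] at h2
    have h3 : φ (t a) ≠ 0 := ((Group.isUnit (t a)).map φ).ne_zero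
    exact (mul_right_cancel₀ h3 h2).symm
  have h2 : ∀ x, φ (u (((a : F) ^ 2 - 1) * x)) = 1 := by
    intro x
    have : ((a : F) ^ 2 - 1) * x = (a : F) ^ 2 * x + - x := by ring
    rw [this, u_add, map_mul, h1, ← map_mul, ← u_add, add_neg_cancel, u_zero, map_one]
  have h3 : ∀ x, φ (u x) = 1 := by
    intro x
    have := h2 (((a : F) ^ 2 - 1)⁻¹ * x)
    rwa [mul_inv_cancel_left₀ (sub_ne_zero.2 ha)] at this
  have h4 := normal_top (MonoidHom.ker φ) h3
  ext g
  have : g ∈ MonoidHom.ker φ := by rw [h4]; trivial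
  exact this

end SLT

namespace SLT
open Matrix

def para {F : Type} [Field F] : (Fˣ × F) ⊕ (F × Fˣ × F) → S F
  | Sum.inl (a, x) => ⟨!![(a : F), x; 0, ((a⁻¹ : Fˣ) : F)], by simp⟩
  | Sum.inr (a, c, d) => ⟨!![a, (a * d - 1) * ((c⁻¹ : Fˣ) : F); (c : F), d], by
      simp [Matrix.det_fin_two]⟩

theorem para_bij {F : Type} [Field F] : Function.Bijective (para (F := F)) := by
  constructor
  · rintro (⟨a, x⟩ | ⟨a, c, d⟩) (⟨a', x'⟩ | ⟨a', c', d'⟩) h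
    all_goals
      have h00 := congrArg (fun g : S F => g.1 0 0) h
      have h01 := congrArg (fun g : S F => g.1 0 1) h
      have h10 := congrArg (fun g : S F => g.1 1 0) h
      have h11 := congrArg (fun g : S F => g.1 1 1) h
      simp [para] at h00 h01 h10 h11
    · simp [Units.ext_iff, h00, h01]
    · exact absurd h10.symm c'.ne_zero
    · simp [Units.ext_iff, h00, h10, h11]
  · intro g
    have hd := det_eq g
    by_cases h : g 1 0 = 0
    · rw [h, mul_zero, sub_zero] at hd
      refine ⟨Sum.inl (⟨g 0 0, g 1 1, hd, by rw [mul_comm, hd]⟩, g 0 1), ?_⟩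
      ext i j
      fin_cases i <;> fin_cases j <;> simp [para, h]
    · refine ⟨Sum.inr (g 0 0, Units.mk0 _ h, g 1 1), ?_⟩
      ext i j
      fin_cases i <;> fin_cases j <;> simp [para]
      field_simp
      linear_combination hd

theorem card_S {F : Type} [Field F] [Fintype F] (r : ℕ) (hr : Fintype.card F = r + 1) :
    Nat.card (S F) = r * (r + 1) + (r + 1) * (r * (r + 1)) := by
  classical
  rw [← Nat.card_congr (Equiv.ofBijective _ (para_bij (F := F)))]
  simp [Nat.card_sum, Nat.card_prod, Nat.card_eq_fintype_card, Fintype.card_units, hr]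

theorem count_aux (r K C A B : ℕ) (hr : 7 ≤ r) (hK : K ≤ 1)
    (h : K + C * r ^ 2 + A * (r + 1) ^ 2 + B * (r + 2) ^ 2 =
      r * (r + 1) + (r + 1) * (r * (r + 1))) : C ≠ 0 ∧ B ≠ 0 := by
  have hz : (K : ℤ) + C * r ^ 2 + A * (r + 1) ^ 2 + B * (r + 2) ^ 2 =
      r * (r + 1) + (r + 1) * (r * (r + 1)) := by exact_mod_cast h
  obtain ⟨q, hq⟩ : ∃ q : ℤ, q = (r : ℤ) + 1 := ⟨_, rfl⟩
  have hq8 : 8 ≤ q := by omega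
  have e : (r : ℤ) = q - 1 := by omega
  rw [e] at hz
  have hA : (0 : ℤ) ≤ A := by positivity
  have hB : (0 : ℤ) ≤ B := by positivity
  have hC : (0 : ℤ) ≤ C := by positivity
  have hK0 : (0 : ℤ) ≤ K := by positivity
  have hK1 : (K : ℤ) ≤ 1 := by exact_mod_cast hK
  have hd : q ∣ (K : ℤ) + C + B :=
    ⟨q ^ 2 - 1 - A * q - B * (q + 2) - C * (q - 2), by linear_combination hz⟩
  obtain ⟨s, hs⟩ := hd
  have hA2 : 0 ≤ (A : ℤ) * q ^ 2 := by positivity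
  constructor
  · rintro rfl
    push_cast at hs hz
    have hBe : (B : ℤ) = q * s - K := by linarith
    rw [hBe] at hz
    have hs0 : s ≤ 0 := by
      by_contra hh
      have : q ≤ q * s := by nlinarith
      have h2 : (q - 1) * (q + 1) ^ 2 ≤ (q * s - K) * (q + 1) ^ 2 := by
        apply mul_le_mul_of_nonneg_right _ (by positivity); linarith
      nlinarith
    have hs1 : s = 0 := by
      by_contra hh
      have : s ≤ -1 := by omega
      nlinarith
    subst hs1
    have hK' : (K : ℤ) = 0 := by nlinarith
    rw [hK'] at hz
    have : q * (A * q) = q * (q ^ 2 - 1) := by linear_combination hz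
    have h3 := mul_left_cancel₀ (by omega) this
    have : q ∣ 1 := ⟨q - A, by linear_combination h3⟩
    have := Int.le_of_dvd (by norm_num) this
    omega
  · rintro rfl
    push_cast at hs hz
    have hCe : (C : ℤ) = q * s - K := by linarith
    rw [hCe] at hz
    have hs0 : s ≤ 1 := by
      by_contra hh
      have : 2 * q ≤ q * s := by nlinarith
      have h2 : (2 * q - 1) * (q - 1) ^ 2 ≤ (q * s - K) * (q - 1) ^ 2 := by
        apply mul_le_mul_of_nonneg_right _ (by positivity); linarith
      nlinarith
    have hs1 : 0 ≤ s := by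
      by_contra hh
      have : s ≤ -1 := by omega
      nlinarith
    have hc : s = 0 ∨ s = 1 := by omega
    have hk : (K : ℤ) = 0 ∨ (K : ℤ) = 1 := by omega
    rcases hc with rfl | rfl
    · have hK' : (K : ℤ) = 0 := by nlinarith
      rw [hK'] at hz
      have : q * (A * q) = q * (q ^ 2 - 1) := by linear_combination hz
      have h3 := mul_left_cancel₀ (by omega) this
      have : q ∣ 1 := ⟨q - A, by linear_combination h3⟩
      have := Int.le_of_dvd (by norm_num) this
      omega
    · rcases hk with hk | hk
      · rw [hk] at hz
        have : q * (A * q) = q * (2 * q - 2) := by linear_combination hz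
        have h3 := mul_left_cancel₀ (by omega) this
        have : q ∣ 2 := ⟨2 - A, by linear_combination h3⟩
        have := Int.le_of_dvd (by norm_num) this
        omega
      · rw [hk] at hz
        have : q * (A * q) = q * (3 * q - 4) := by linear_combination hz
        have h3 := mul_left_cancel₀ (by omega) this
        have : q ∣ 4 := ⟨3 - A, by linear_combination h3⟩
        have := Int.le_of_dvd (by norm_num) this
        omega

theorem degrees {F : Type} [Field F] [Fintype F] [CharP F 2] (r : ℕ)
    (hr : Fintype.card F = r + 1) (h7 : 7 ≤ r) :
    (∀ n ∈ charDegrees (S F), n = 1 ∨ n = r ∨ n = r + 1 ∨ n = r + 2) ∧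
      r ∈ charDegrees (S F) ∧ r + 2 ∈ charDegrees (S F) := by
  classical
  have hall : ∀ n ∈ charDegrees (S F), n = 1 ∨ n = r ∨ n = r + 1 ∨ n = r + 2 := by
    intro n hn
    obtain ⟨V, _, _, _, ρ, hρ, rfl⟩ := mem_irr hn
    have := dims ρ hρ
    rw [hr] at this
    omega
  refine ⟨hall, ?_⟩
  obtain ⟨n, d, hd, hsum, huniq, -, -⟩ := wedderburn_G (S F)
  have huniq := huniq (hom_trivial (by omega))
  rw [card_S r hr] at hsum
  let N : ℕ → ℕ := fun m => (Finset.univ.filter (fun i => d i = m)).card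
  have hN : ∀ m, N m * m ^ 2 = ∑ i, if d i = m then m ^ 2 else 0 := by
    intro m
    rw [Finset.sum_ite, Finset.sum_const, Finset.sum_const_zero, add_zero, smul_eq_mul]
  have hpos : ∀ m, N m ≠ 0 → m ∈ charDegrees (S F) := by
    intro m hm
    obtain ⟨i, hi⟩ := Finset.card_pos.1 (Nat.pos_of_ne_zero hm)
    have := (Finset.mem_filter.1 hi).2
    exact this ▸ hd i
  have key := count_aux r (N 1) (N r) (N (r + 1)) (N (r + 2)) h7 ?_ ?_
  · exact ⟨hpos _ key.1, hpos _ key.2⟩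
  · apply Finset.card_le_one.2
    intro i hi j hj
    exact huniq i j (Finset.mem_filter.1 hi).2 (Finset.mem_filter.1 hj).2
  · rw [← hsum]
    have h1 := hN 1
    rw [one_pow, mul_one] at h1
    rw [h1, hN, hN, hN, ← Finset.sum_add_distrib, ← Finset.sum_add_distrib,
      ← Finset.sum_add_distrib]
    apply Finset.sum_congr rfl
    intro i _
    rcases hall _ (hd i) with h | h | h | h <;> rw [h] <;> split_ifs <;> first | omega | simp

theorem center_bot {F : Type} [Field F] [Fintype F] [CharP F 2] : Subgroup.center (S F) = ⊥ := by
  rw [eq_bot_iff]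
  intro g hg
  rw [Matrix.SpecialLinearGroup.mem_center_iff] at hg
  obtain ⟨r, hr, hg⟩ := hg
  have : r = 1 := sq_one r (by simpa using hr)
  rw [Subgroup.mem_bot]
  apply Subtype.ext
  rw [← hg, this]
  simp

end SLT

theorem no_four {G : Type} [Group G] (h4 : (charGraph G).CliqueFree 4) (n : ℕ)
    (hn : n ∈ charDegrees G) (s : Finset ℕ) (hs : s ⊆ n.primeFactors) :
    s.card ≠ 4 := by
  intro hc
  have hmem : ∀ p ∈ s, p ∈ charPrimes G := fun p hp =>
    ⟨Nat.prime_of_mem_primeFactors (hs hp), n, hn, Nat.dvd_of_mem_primeFactors (hs hp)⟩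
  let e : s ↪ charPrimes G := ⟨fun p => ⟨p.1, hmem p.1 p.2⟩, by
    intro a b h
    exact Subtype.ext (congrArg (fun z : charPrimes G => (z : ℕ)) h)⟩
  refine h4 (s.attach.map e) ⟨?_, by simp [hc]⟩
  intro a ha b hb hab
  simp only [Finset.coe_map, Set.mem_image] at ha hb
  obtain ⟨⟨a', ha'⟩, -, rfl⟩ := ha
  obtain ⟨⟨b', hb'⟩, -, rfl⟩ := hb
  have hne : a' ≠ b' := by
    rintro rfl; exact hab rfl
  refine ⟨hne, n, hn, ?_⟩
  have ha2 := hs ha'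
  have hb2 := hs hb'
  exact Nat.Coprime.mul_dvd_of_dvd_of_dvd
    ((Nat.coprime_primes (Nat.prime_of_mem_primeFactors ha2)
      (Nat.prime_of_mem_primeFactors hb2)).2 hne)
    (Nat.dvd_of_mem_primeFactors ha2) (Nat.dvd_of_mem_primeFactors hb2)

theorem graph_final {G : Type} [Group G] (r f : ℕ) (hr : r + 1 = 2 ^ f) (h7r : 7 ≤ r)
    (h7 : Nat.card ↥(charPrimes G) = 7)
    (hm : r.primeFactors.card = 3) (hp : (r + 2).primeFactors.card = 3)
    (hall : ∀ n ∈ charDegrees G, n = 1 ∨ n = r ∨ n = r + 1 ∨ n = r + 2)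
    (hA : r ∈ charDegrees G) (hB : r + 2 ∈ charDegrees G) (hodd : r % 2 = 1) :
    Nonempty (charGraph G ≃g (((⊤ : SimpleGraph (Fin 3)) ⊕g (⊤ : SimpleGraph (Fin 1))) ⊕g
      (⊤ : SimpleGraph (Fin 3)))) := by
  classical
  have hcop : Nat.Coprime r (r + 2) := by
    rw [Nat.coprime_self_add_right, Nat.coprime_two_right]
    exact Nat.odd_iff.2 hodd
  have hdisj := hcop.disjoint_primeFactors
  have h2r : 2 ∉ r.primeFactors := fun h => by
    have := Nat.dvd_of_mem_primeFactors h; omega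
  have h2r' : 2 ∉ (r + 2).primeFactors := fun h => by
    have := Nat.dvd_of_mem_primeFactors h; omega
  have hsub : charPrimes G ⊆ ((r.primeFactors ∪ {2} ∪ (r + 2).primeFactors : Finset ℕ) : Set ℕ) := by
    rintro p ⟨pp, n, hn, hd⟩
    simp only [Finset.coe_union, Finset.coe_singleton, Set.mem_union, Finset.mem_coe,
      Set.mem_singleton_iff]
    rcases hall n hn with rfl | rfl | rfl | rfl
    · exact absurd (Nat.dvd_one.1 hd) pp.ne_one
    · left; left; exact Nat.mem_primeFactors.2 ⟨pp, hd, by omega⟩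
    · left; right
      rw [hr] at hd
      exact (Nat.prime_dvd_prime_iff_eq pp Nat.prime_two).1 (pp.dvd_of_dvd_pow hd)
    · right; exact Nat.mem_primeFactors.2 ⟨pp, hd, by omega⟩
  have hcard : (r.primeFactors ∪ {2} ∪ (r + 2).primeFactors : Finset ℕ).card = 7 := by
    rw [Finset.card_union_of_disjoint, Finset.card_union_of_disjoint, hm, hp]
    · simp
    · simpa using h2r
    · rw [Finset.disjoint_union_left]
      exact ⟨hdisj, by simpa using h2r'⟩
  have heq : charPrimes G = ((r.primeFactors ∪ {2} ∪ (r + 2).primeFactors : Finset ℕ) : Set ℕ) := by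
    apply Set.eq_of_subset_of_ncard_le hsub _ (Finset.finite_toSet _)
    rw [Set.ncard_coe_finset, hcard, ← h7]
    exact le_rfl
  have hadj : ∀ p q : charPrimes G, (charGraph G).Adj p q ↔ (p : ℕ) ≠ q ∧
      (((p : ℕ) ∈ r.primeFactors ∧ (q : ℕ) ∈ r.primeFactors) ∨
       ((p : ℕ) ∈ (r + 2).primeFactors ∧ (q : ℕ) ∈ (r + 2).primeFactors)) := by
    rintro ⟨p, hpp⟩ ⟨q, hqq⟩
    have pp := hpp.1
    have pq := hqq.1
    change (p ≠ q ∧ ∃ n ∈ charDegrees G, p * q ∣ n) ↔ _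
    simp only [Nat.mem_primeFactors]
    constructor
    · rintro ⟨hne, n, hn, hd⟩
      have h1 := dvd_of_mul_right_dvd hd
      have h2 := dvd_of_mul_left_dvd hd
      refine ⟨hne, ?_⟩
      rcases hall n hn with rfl | rfl | rfl | rfl
      · exact absurd (Nat.dvd_one.1 h1) pp.ne_one
      · left; exact ⟨⟨pp, h1, by omega⟩, pq, h2, by omega⟩
      · exfalso
        rw [hr] at h1 h2
        have e1 := (Nat.prime_dvd_prime_iff_eq pp Nat.prime_two).1 (pp.dvd_of_dvd_pow h1)
        have e2 := (Nat.prime_dvd_prime_iff_eq pq Nat.prime_two).1 (pq.dvd_of_dvd_pow h2)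
        exact hne (e1.trans e2.symm)
      · right; exact ⟨⟨pp, h1, by omega⟩, pq, h2, by omega⟩
    · rintro ⟨hne, h⟩
      have hc := (Nat.coprime_primes pp pq).2 hne
      refine ⟨hne, ?_⟩
      rcases h with ⟨h1, h2⟩ | ⟨h1, h2⟩
      · exact ⟨r, hA, hc.mul_dvd_of_dvd_of_dvd h1.2.1 h2.2.1⟩
      · exact ⟨r + 2, hB, hc.mul_dvd_of_dvd_of_dvd h1.2.1 h2.2.1⟩
  let e1 : Fin 3 ≃ r.primeFactors := (Finset.equivFinOfCardEq hm).symm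
  let e2 : Fin 3 ≃ (r + 2).primeFactors := (Finset.equivFinOfCardEq hp).symm
  let g : (Fin 3 ⊕ Fin 1) ⊕ Fin 3 → ℕ :=
    Sum.elim (Sum.elim (fun i => (e1 i : ℕ)) (fun _ => 2)) (fun i => (e2 i : ℕ))
  have hd' := Finset.disjoint_left.1 hdisj
  have hmem : ∀ x, g x ∈ charPrimes G := by
    rw [heq]
    rintro ((i | i) | i) <;> simp only [Finset.coe_union, Finset.coe_singleton, Set.mem_union,
      Finset.mem_coe, Set.mem_singleton_iff]
    · left; left; exact (e1 i).2
    · left; right; rfl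
    · right; exact (e2 i).2
  let φ : (Fin 3 ⊕ Fin 1) ⊕ Fin 3 → charPrimes G := fun x => ⟨g x, hmem x⟩
  have n1 : ∀ i j, (e1 i : ℕ) ≠ e2 j := fun i j h =>
    hd' (e1 i).2 (by rw [h]; exact (e2 j).2)
  have n2 : ∀ i, (e1 i : ℕ) ≠ 2 := fun i h => h2r (by rw [← h]; exact (e1 i).2)
  have n3 : ∀ i, (e2 i : ℕ) ≠ 2 := fun i h => h2r' (by
    have := (e2 i).2
    rwa [h] at this)
  have i1 : ∀ i j, (e1 i : ℕ) = e1 j ↔ i = j := fun i j => by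
    rw [← Subtype.ext_iff, e1.apply_eq_iff_eq]
  have i2 : ∀ i j, (e2 i : ℕ) = e2 j ↔ i = j := fun i j => by
    rw [← Subtype.ext_iff, e2.apply_eq_iff_eq]
  have hinj : Function.Injective φ := by
    intro x y hxy
    have h : g x = g y := congrArg (fun z : charPrimes G => (z : ℕ)) hxy
    rcases x with (i | i) | i <;> rcases y with (j | j) | j <;>
      simp only [g, Sum.elim_inl, Sum.elim_inr] at h
    · rw [(i1 i j).1 h]
    · exact absurd h (n2 i)
    · exact absurd h (n1 i j)
    · exact absurd h.symm (n2 j)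
    · rw [Subsingleton.elim i j]
    · exact absurd h.symm (n3 j)
    · exact absurd h.symm (n1 j i)
    · exact absurd h (n3 i)
    · rw [(i2 i j).1 h]
  have hfin : Finite (charPrimes G) := Nat.finite_of_card_ne_zero (by omega)
  have hbij : Function.Bijective φ := by
    rw [Nat.bijective_iff_injective_and_card]
    exact ⟨hinj, by rw [h7]; simp⟩
  refine ⟨RelIso.symm ⟨Equiv.ofBijective φ hbij, ?_⟩⟩
  intro x y
  rw [hadj]
  simp only [Equiv.ofBijective_apply]
  change (g x ≠ g y ∧ ((g x ∈ r.primeFactors ∧ g y ∈ r.primeFactors) ∨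
    (g x ∈ (r + 2).primeFactors ∧ g y ∈ (r + 2).primeFactors))) ↔ _
  have a1 : ∀ i, (e1 i : ℕ) ∈ r.primeFactors := fun i => (e1 i).2
  have a2 : ∀ i, (e2 i : ℕ) ∈ (r + 2).primeFactors := fun i => (e2 i).2
  have a3 : ∀ i, (e1 i : ℕ) ∉ (r + 2).primeFactors := fun i => hd' (e1 i).2
  have a4 : ∀ i, (e2 i : ℕ) ∉ r.primeFactors := fun i h => hd' h (e2 i).2
  rcases x with (i | i) | i <;> rcases y with (j | j) | j <;>
    simp only [g, Sum.elim_inl, Sum.elim_inr, SimpleGraph.sum_adj, a1, a2, a3, a4, h2r, h2r', ne_eq,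
      i1, i2, SimpleGraph.top_adj] <;> simp
  all_goals omega

theorem stmt3 (G : Type) [Group G] [Finite G]
    (h4 : (charGraph G).CliqueFree 4)
    (h7 : Nat.card ↥(charPrimes G) = 7)
    (f : ℕ) (hf : 2 ≤ f)
    (hiso : Nonempty (G ≃* PSL2 (GaloisField 2 f) × ↥(solvableRadical G)))
    (hm : (2 ^ f - 1).primeFactors.card = 3)
    (hp : (2 ^ f + 1).primeFactors.card = 3) :
    (∀ x y : ↥(solvableRadical G), x * y = y * x) ∧
    Nonempty (charGraph G ≃g (((⊤ : SimpleGraph (Fin 3)) ⊕g (⊤ : SimpleGraph (Fin 1))) ⊕g (⊤ : SimpleGraph (Fin 3)))) := by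
  classical
  have : Finite (GaloisField 2 f) := inferInstance
  letI : Fintype (GaloisField 2 f) := Fintype.ofFinite _
  have hcF : Fintype.card (GaloisField 2 f) = 2 ^ f := by
    rw [← Nat.card_eq_fintype_card]; exact GaloisField.card 2 f (by omega)
  obtain ⟨r, hr⟩ : ∃ r, 2 ^ f = r + 1 := ⟨2 ^ f - 1, by
    have := Nat.one_le_two_pow (n := f); omega⟩
  have hev : 2 ∣ 2 ^ f := dvd_pow_self 2 (by omega)
  have hodd : r % 2 = 1 := by omega
  have e1 : 2 ^ f - 1 = r := by omega
  have e2 : 2 ^ f + 1 = r + 2 := by omega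
  rw [e1] at hm
  rw [e2] at hp
  have h7r : 7 ≤ r := by
    by_contra hlt
    have h1 : r.primeFactors ⊆ ({2, 3, 5} : Finset ℕ) := by
      intro p hpr
      have h1 := Nat.prime_of_mem_primeFactors hpr
      have h2 := Nat.le_of_mem_primeFactors hpr
      have h3 : p < 7 := by omega
      interval_cases p <;> first | decide | (exfalso; revert h1; decide)
    have h2 := Finset.eq_of_subset_of_card_le h1 (by rw [hm]; decide)
    have h3 : 2 ∈ r.primeFactors := by rw [h2]; decide
    have h4 := Nat.dvd_of_mem_primeFactors h3
    omega
  obtain ⟨hall, hA, hB⟩ := SLT.degrees (F := GaloisField 2 f) r (by rw [hcF, hr]) h7r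
  obtain ⟨iso⟩ := hiso
  have iso2 : PSL2 (GaloisField 2 f) ≃* SLT.S (GaloisField 2 f) :=
    (QuotientGroup.quotientMulEquivOfEq SLT.center_bot).trans QuotientGroup.quotientBot
  have iso3 : G ≃* SLT.S (GaloisField 2 f) × ↥(solvableRadical G) :=
    iso.trans (iso2.prodCongr (MulEquiv.refl _))
  have hcd := charDegrees_equiv iso3
  have hab : ∀ x y : ↥(solvableRadical G), x * y = y * x := by
    obtain ⟨n, d, hd, -, -, hcomm, hd0⟩ := wedderburn_G ↥(solvableRadical G)
    apply hcomm
    intro i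
    by_contra h1
    obtain ⟨p, hpp, hpd⟩ := Nat.exists_prime_and_dvd h1
    have key : ∀ m ∈ charDegrees (SLT.S (GaloisField 2 f)), m ≠ 0 → m.primeFactors.card = 3 →
        p ∣ m := by
      intro m hm hm0 hm3
      by_contra hpm
      have hmem : m * d i ∈ charDegrees G := by
        rw [hcd]; exact irr_degree_prod hm (hd i)
      refine no_four h4 _ hmem (insert p m.primeFactors) ?_ ?_
      · rw [Nat.primeFactors_mul hm0 (hd0 i)]
        intro x hx
        rcases Finset.mem_insert.1 hx with rfl | hx
        · exact Finset.mem_union_right _ (Nat.mem_primeFactors.2 ⟨hpp, hpd, hd0 i⟩)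
        · exact Finset.mem_union_left _ hx
      · rw [Finset.card_insert_of_notMem (fun h => hpm (Nat.dvd_of_mem_primeFactors h)), hm3]
    have k1 := key _ hA (by omega) hm
    have k2 := key _ hB (by omega) hp
    have k3 : p ∣ 2 := (Nat.dvd_add_right k1).1 k2
    have k4 := (Nat.prime_dvd_prime_iff_eq hpp Nat.prime_two).1 k3
    subst k4
    omega
  refine ⟨hab, graph_final r f hr.symm h7r h7 hm hp ?_ ?_ ?_ hodd⟩
  · intro n hn
    rw [hcd] at hn
    exact hall n (irr_degree_prod_comm hab hn)
  · rw [hcd]; simpa using irr_degree_prod hA (one_mem_charDegrees (G := ↥(solvableRadical G)))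
  · rw [hcd]; simpa using irr_degree_prod hB (one_mem_charDegrees (G := ↥(solvableRadical G)))
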